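/- arXiv:2401.06062 — 3 statements merged into one kernel-verified Lean document; each statement's English description precedes it below -/
import Mathlib

section
/- Let G be a finite group and S ⊆ G∖{1} with S ≠ ∅ and S ∪ S⁻¹ ≠ G∖{1}. Then the Cayley digraph Cay(G,S) (vertex set G, with an edge from x to y iff x⁻¹y ∈ S) has a non-trivial bihomogeneous set if and only if there exists a subgroup H of G with {1} ≠ H ≠ G such that HgH ⊆ S for every g ∈ S∖H. -/
open scoped Pointwise

/-- A set `H` of vertices of a digraph (given by its adjacency relation `A`) is
in-homogeneous if every vertex `v` outside `H` satisfies: either `v h` is an edge for all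
`h ∈ H`, or for none of them. -/
def IsInHomogeneous {V : Type*} (A : V → V → Prop) (H : Set V) : Prop :=
  ∀ v ∉ H, (∀ h ∈ H, A v h) ∨ (∀ h ∈ H, ¬ A v h)

/-- Out-homogeneous: edges from `H` to the outside vertex. -/
def IsOutHomogeneous {V : Type*} (A : V → V → Prop) (H : Set V) : Prop :=
  ∀ v ∉ H, (∀ h ∈ H, A h v) ∨ (∀ h ∈ H, ¬ A h v)

/-- Bihomogeneous: both in- and out-homogeneous. -/
def IsBihomogeneous {V : Type*} (A : V → V → Prop) (H : Set V) : Prop :=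
  IsInHomogeneous A H ∧ IsOutHomogeneous A H

theorem isBihomogeneous_iff {V : Type*} {A : V → V → Prop} {X : Set V} :
    IsBihomogeneous A X ↔ ∀ v ∉ X, ∀ x ∈ X, ∀ y ∈ X, (A v x ↔ A v y) ∧ (A x v ↔ A y v) := by
  constructor
  · rintro ⟨hin, hout⟩ v hv x hx y hy
    refine ⟨?_, ?_⟩
    · rcases hin v hv with h | h <;> simp [h x hx, h y hy]
    · rcases hout v hv with h | h <;> simp [h x hx, h y hy]
  · refine fun h => ⟨fun v hv => ?_, fun v hv => ?_⟩
    · by_cases hA : ∃ x ∈ X, A v x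
      · obtain ⟨x, hx, hvx⟩ := hA
        exact .inl fun y hy => (h v hv x hx y hy).1.1 hvx
      · exact .inr fun y hy hvy => hA ⟨y, hy, hvy⟩
    · by_cases hA : ∃ x ∈ X, A x v
      · obtain ⟨x, hx, hxv⟩ := hA
        exact .inl fun y hy => (h v hv x hx y hy).2.1 hxv
      · exact .inr fun y hy hyv => hA ⟨y, hy, hyv⟩

theorem IsBihomogeneous.inter {V : Type*} {A : V → V → Prop} {X Y : Set V}
    (hX : IsBihomogeneous A X) (hY : IsBihomogeneous A Y) : IsBihomogeneous A (X ∩ Y) := by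
  rw [isBihomogeneous_iff] at *
  intro v hv x hx y hy
  by_cases hvX : v ∈ X
  · exact hY v (fun hvY => hv ⟨hvX, hvY⟩) x hx.2 y hy.2
  · exact hX v hvX x hx.1 y hy.1

theorem IsBihomogeneous.sdiff {V : Type*} {A : V → V → Prop} {X Y : Set V}
    (hX : IsBihomogeneous A X) (hY : IsBihomogeneous A Y) (hYX : (Y \ X).Nonempty) :
    IsBihomogeneous A (X \ Y) := by
  rw [isBihomogeneous_iff] at *
  obtain ⟨w, hwY, hwX⟩ := hYX
  intro v hv x hx y hy
  by_cases hvX : v ∈ X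
  · have hvY : v ∈ Y := by_contra fun h => hv ⟨hvX, h⟩
    have h₁ := hY x hx.2 v hvY w hwY
    have h₂ := hY y hy.2 v hvY w hwY
    have h₃ := hX w hwX x hx.1 y hy.1
    tauto
  · exact hX v hvX x hx.1 y hy.1

theorem IsBihomogeneous.smul {G : Type*} [Group G] {S X : Set G}
    (hX : IsBihomogeneous (fun x y : G => x⁻¹ * y ∈ S) X) (g : G) :
    IsBihomogeneous (fun x y : G => x⁻¹ * y ∈ S) (g • X) := by
  rw [isBihomogeneous_iff] at *
  rintro v hv _ ⟨x, hx, rfl⟩ _ ⟨y, hy, rfl⟩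
  have h := hX (g⁻¹ * v) (fun h => hv ⟨_, h, by simp⟩) x hx y hy
  simpa [mul_assoc] using h

/-- A subgroup is bihomogeneous in `Cay(G,S)` iff `S∖H` is a union of double cosets of `H`. -/
theorem Subgroup.isBihomogeneous_iff_mul_mem {G : Type*} [Group G] {S : Set G}
    (H : Subgroup G) :
    IsBihomogeneous (fun x y : G => x⁻¹ * y ∈ S) (H : Set G) ↔
      ∀ g ∈ S, g ∉ H → ∀ h ∈ H, ∀ h' ∈ H, h * g * h' ∈ S := by
  rw [isBihomogeneous_iff]
  constructor
  · intro hH g hg hgH h hh h' hh'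
    have h₁ : g * h' ∈ S := by
      have := (hH g⁻¹ (by simpa using hgH) 1 H.one_mem h' hh').1
      simp only [inv_inv, mul_one] at this
      exact this.1 hg
    have h₂ := (hH (g * h') (by simpa [H.mul_mem_cancel_right hh'] using hgH)
      1 H.one_mem h⁻¹ (H.inv_mem hh)).2
    simp only [inv_one, one_mul, inv_inv, ← mul_assoc] at h₂
    exact h₂.1 (by simpa using h₁)
  · intro hH
    have hin : ∀ v ∉ H, ∀ x ∈ H, ∀ y ∈ H, v⁻¹ * x ∈ S → v⁻¹ * y ∈ S := by
      intro v hv x hx y hy hvx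
      have := hH _ hvx (by simpa [H.mul_mem_cancel_right hx] using hv) 1 H.one_mem
        (x⁻¹ * y) (H.mul_mem (H.inv_mem hx) hy)
      simpa [mul_assoc] using this
    have hout : ∀ v ∉ H, ∀ x ∈ H, ∀ y ∈ H, x⁻¹ * v ∈ S → y⁻¹ * v ∈ S := by
      intro v hv x hx y hy hxv
      have := hH _ hxv (by simpa [H.mul_mem_cancel_left (H.inv_mem hx)] using hv)
        (y⁻¹ * x) (H.mul_mem (H.inv_mem hy) hx) 1 H.one_mem
      simpa [mul_assoc] using this
    exact fun v hv x hx y hy => ⟨⟨hin v hv x hx y hy, hin v hv y hy x hx⟩,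
      ⟨hout v hv x hx y hy, hout v hv y hy x hx⟩⟩

/-- If a pair `{1, a}` is bihomogeneous, then so is the cyclic subgroup generated by `a`. -/
theorem IsBihomogeneous.zpowers {G : Type*} [Group G] {S : Set G} {a : G}
    (ha : IsBihomogeneous (fun x y : G => x⁻¹ * y ∈ S) {1, a}) :
    IsBihomogeneous (fun x y : G => x⁻¹ * y ∈ S) (Subgroup.zpowers a : Set G) := by
  have key : ∀ v ∉ Subgroup.zpowers a, ∀ n : ℤ,
      (v⁻¹ * a ^ n ∈ S ↔ v⁻¹ ∈ S) ∧ ((a ^ n)⁻¹ * v ∈ S ↔ v ∈ S) := by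
    intro v hv n
    have step : ∀ m : ℤ, (v⁻¹ * a ^ m ∈ S ↔ v⁻¹ * a ^ (m + 1) ∈ S) ∧
        ((a ^ m)⁻¹ * v ∈ S ↔ (a ^ (m + 1))⁻¹ * v ∈ S) := by
      intro m
      refine isBihomogeneous_iff.1 (ha.smul (a ^ m)) v ?_ (a ^ m) ⟨1, by simp⟩
        (a ^ (m + 1)) ⟨a, by simp [zpow_add_one]⟩
      rintro ⟨x, rfl | rfl, rfl⟩
      · exact hv ⟨m, by simp⟩
      · exact hv ⟨m + 1, by simp [zpow_add_one]⟩
    induction n with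
    | zero => simp
    | succ k ih => have := step k; tauto
    | pred k ih => have := step (-k - 1); rw [sub_add_cancel] at this; tauto
  rw [isBihomogeneous_iff]
  rintro v hv _ ⟨m, rfl⟩ _ ⟨n, rfl⟩
  have h₁ := key v hv m
  have h₂ := key v hv n
  dsimp only
  tauto

/-- If `a` generates a finite group `G` and `{1, a}` is bihomogeneous in `Cay(G,S)`, then
`Cay(G,S)` is empty or complete. -/
theorem IsBihomogeneous.mem_of_zpowers_eq_top {G : Type*} [Group G] [Finite G] {S : Set G}
    {a : G} (ha : IsBihomogeneous (fun x y : G => x⁻¹ * y ∈ S) {1, a})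
    (htop : Subgroup.zpowers a = ⊤) (hone : (1 : G) ∉ S) (hS : S.Nonempty) {g : G}
    (hg : g ≠ 1) : g ∈ S := by
  have step : ∀ k : ℕ, a ^ k ≠ 1 → a ^ (k + 1) ≠ 1 → (a ^ k ∈ S ↔ a ^ (k + 1) ∈ S) := by
    intro k h₁ h₂
    have := (isBihomogeneous_iff.1 ha (a ^ (k + 1)) (by
      rintro (h | h)
      · exact h₂ h
      · rw [Set.mem_singleton_iff, pow_succ, mul_eq_right] at h
        exact h₁ h) 1 (by simp) a (by simp)).2
    simp only [inv_one, one_mul, pow_succ', inv_mul_cancel_left] at this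
    rw [pow_succ']
    exact this.symm
  have key : ∀ k : ℕ, k + 1 < orderOf a → (a ^ (k + 1) ∈ S ↔ a ∈ S) := by
    intro k hk
    induction k with
    | zero => simp
    | succ k ih =>
      rw [← step (k + 1) (pow_ne_one_of_lt_orderOf (by omega) (by omega))
        (pow_ne_one_of_lt_orderOf (by omega) hk)]
      exact ih (by omega)
  have all : ∀ x : G, x ≠ 1 → (x ∈ S ↔ a ∈ S) := by
    intro x hx
    classical
    have hx' : x ∈ Subgroup.zpowers a := htop ▸ Subgroup.mem_top x
    rw [mem_zpowers_iff_mem_range_orderOf] at hx'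
    obtain ⟨k, hk, rfl⟩ := Finset.mem_image.1 hx'
    rw [Finset.mem_range] at hk
    obtain _ | k := k
    · simp at hx
    · exact key k hk
  obtain ⟨s, hs⟩ := hS
  exact (all g hg).2 ((all s fun h => hone (h ▸ hs)).1 hs)

/-- A set containing `1` whose left translates are pairwise equal or disjoint is a subgroup. -/
theorem exists_subgroup_coe_eq_of_smul_eq {G : Type*} [Group G] {X : Set G} (hone : 1 ∈ X)
    (hX : ∀ g : G, (X ∩ g • X).Nonempty → g • X = X) : ∃ H : Subgroup G, (H : Set G) = X := by
  refine ⟨MulAction.stabilizer G X, Set.ext fun x => ⟨fun hx => ?_, fun hx => ?_⟩⟩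
  · rw [SetLike.mem_coe, MulAction.mem_stabilizer_iff] at hx
    rw [← hx]
    exact ⟨1, hone, by simp⟩
  · exact hX x ⟨x, hx, 1, hone, by simp⟩

/-- Let `G` be a finite group and `S ⊆ G∖{1}` with `S ≠ ∅` and `S ∪ S⁻¹ ≠ G∖{1}`. The
Cayley digraph `Cay(G,S)` (edge from `x` to `y` iff `x⁻¹y ∈ S`) has a non-trivial
bihomogeneous set iff there is a subgroup `{1} ≠ H ≠ G` with `HgH ⊆ S` for every
`g ∈ S∖H`. -/
theorem cayley_digraph_bihomogeneous_iff {G : Type*} [Group G] [Fintype G]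
    (S : Set G) (hone : (1 : G) ∉ S) (hSne : S.Nonempty)
    (hSneq : S ∪ S⁻¹ ≠ {g : G | g ≠ 1}) :
    (∃ X : Set G, IsBihomogeneous (fun x y : G => x⁻¹ * y ∈ S) X ∧
        2 ≤ X.ncard ∧ X.ncard < Fintype.card G) ↔
      ∃ H : Subgroup G, H ≠ ⊥ ∧ H ≠ ⊤ ∧
        ∀ g ∈ S, g ∉ H → ∀ h ∈ H, ∀ h' ∈ H, h * g * h' ∈ S := by
  have hSuniv : ¬ ∀ g : G, g ≠ 1 → g ∈ S := by
    intro h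
    refine hSneq (Set.ext fun g => ⟨?_, fun hg => .inl (h g hg)⟩)
    rintro (hg | hg) rfl
    · exact hone hg
    · exact hone (by simpa using hg)
  simp only [← Subgroup.isBihomogeneous_iff_mul_mem]
  constructor
  · intro hex
    obtain ⟨Y, ⟨hY, hY2, hYlt⟩, hmin⟩ := exists_minimalFor_of_wellFoundedLT _ Set.ncard hex
    obtain ⟨y, hy⟩ := Set.nonempty_of_ncard_ne_zero (by omega : Y.ncard ≠ 0)
    obtain ⟨X, hXB, hone_mem, hcard⟩ : ∃ X : Set G,
        IsBihomogeneous (fun x y : G => x⁻¹ * y ∈ S) X ∧ 1 ∈ X ∧ X.ncard = Y.ncard :=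
      ⟨y⁻¹ • Y, hY.smul _, ⟨y, hy, by simp⟩, Set.ncard_smul_set _ _⟩
    by_cases hblock : ∀ g : G, (X ∩ g • X).Nonempty → g • X = X
    · obtain ⟨H, rfl⟩ := exists_subgroup_coe_eq_of_smul_eq hone_mem hblock
      refine ⟨H, ?_, ?_, hXB⟩
      · rintro rfl
        simp at hcard
        omega
      · rintro rfl
        simp [Set.ncard_univ] at hcard
        omega
    · push Not at hblock
      obtain ⟨g, hmeet, hne⟩ := hblock
      have hgcard : (g • X).ncard = X.ncard := Set.ncard_smul_set _ _
      have hdiff : (g • X \ X).Nonempty := by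
        rw [Set.sdiff_nonempty]
        exact fun h => hne (Set.eq_of_subset_of_ncard_le h hgcard.ge)
      have hdiff' : (X \ g • X).Nonempty := by
        rw [Set.sdiff_nonempty]
        exact fun h => hne (Set.eq_of_subset_of_ncard_le h hgcard.le).symm
      have hsum := Set.ncard_inter_add_ncard_sdiff_eq_ncard X (g • X)
      have hpos := (Set.ncard_pos (s := X ∩ g • X)).2 hmeet
      have hpos' := (Set.ncard_pos (s := X \ g • X)).2 hdiff'
      have small : ∀ Z : Set G, IsBihomogeneous (fun x y : G => x⁻¹ * y ∈ S) Z →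
          Z.ncard < X.ncard → Z.ncard < 2 := by
        intro Z hZ hlt
        by_contra! h2
        have := hmin ⟨hZ, h2, by omega⟩ (by omega)
        omega
      have h₁ := small _ (hXB.inter (hXB.smul g)) (by omega)
      have h₂ := small _ (hXB.sdiff (hXB.smul g) hdiff) (by omega)
      obtain ⟨a, ha, rfl⟩ : ∃ a : G, a ≠ 1 ∧ X = {1, a} := by
        obtain ⟨b, c, hbc, rfl⟩ := Set.ncard_eq_two.1 (by omega : X.ncard = 2)
        rcases hone_mem with rfl | rfl
        · exact ⟨c, hbc.symm, rfl⟩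
        · exact ⟨b, hbc, Set.pair_comm _ _⟩
      exact ⟨Subgroup.zpowers a, by simpa using ha,
        fun htop => hSuniv fun g => hXB.mem_of_zpowers_eq_top htop hone hSne, hXB.zpowers⟩
  · rintro ⟨H, hbot, htop, hH⟩
    refine ⟨H, hH, ?_, ?_⟩
    · exact (Subgroup.one_lt_card_iff_ne_bot H).2 hbot
    · rw [← Nat.card_eq_fintype_card, ← Set.ncard_univ]
      exact Set.ncard_lt_ncard (Set.ssubset_univ_iff.2 (by simpa using htop))
end

section
/- Let R be a finite commutative semisimple ring (i.e., the Jacobson radical of R is zero) and let S be a subgroup of R^× with −1 ∈ S. Suppose Cay(R,S) is connected and anti-connected. Then Cay(R,S) is prime. -/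
/-- A set `H` of vertices of a simple graph `G` is homogeneous if every vertex outside `H`
is adjacent to either all or none of the vertices of `H`. -/
def SimpleGraph.IsHomogeneousSet {V : Type*} (G : SimpleGraph V) (H : Set V) : Prop :=
  ∀ v ∉ H, (∀ h ∈ H, G.Adj v h) ∨ (∀ h ∈ H, ¬ G.Adj v h)

namespace SimpleGraph

variable {V W : Type*} {G : SimpleGraph V} {G' : SimpleGraph W}

theorem Connected.forall_of_adj (hG : G.Connected) {P : V → Prop} {a : V} (ha : P a)
    (h : ∀ v w, G.Adj v w → P v → P w) (b : V) : P b := by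
  obtain ⟨p⟩ := hG.preconnected a b
  induction p with
  | nil => exact ha
  | cons hadj _ ih => exact ih (h _ _ hadj ha)

theorem IsHomogeneousSet.preimage {H : Set W} (hH : G'.IsHomogeneousSet H) {f : V → W}
    (hf : ∀ a b, G'.Adj (f a) (f b) ↔ G.Adj a b) : G.IsHomogeneousSet (f ⁻¹' H) :=
  fun v hv => (hH (f v) hv).imp (fun h x hx => (hf v x).1 (h _ hx))
    fun h x hx hadj => h _ hx ((hf v x).2 hadj)

theorem IsHomogeneousSet.union {A B : Set V} (hA : G.IsHomogeneousSet A)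
    (hB : G.IsHomogeneousSet B) {c : V} (hcA : c ∈ A) (hcB : c ∈ B) :
    G.IsHomogeneousSet (A ∪ B) := by
  intro v hv
  rw [Set.mem_union, not_or] at hv
  have h₁ := hA v hv.1
  have h₂ := hB v hv.2
  grind

/-- In a connected and anti-connected graph, two proper homogeneous sets that meet do not
cover all the vertices. -/
theorem IsHomogeneousSet.union_ne_univ (hG : G.Connected) (hG' : Gᶜ.Connected) {A B : Set V}
    (hA : G.IsHomogeneousSet A) (hB : G.IsHomogeneousSet B) (hA' : A ≠ Set.univ)
    (hB' : B ≠ Set.univ) {c : V} (hcB : c ∈ B) : A ∪ B ≠ Set.univ := by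
  intro hAB
  have mem (v : V) : v ∈ A ∨ v ∈ B := (Set.ext_iff.1 hAB v).2 trivial
  obtain ⟨x, hx⟩ := (Set.ne_univ_iff_exists_notMem B).1 hB'
  obtain ⟨y, hy⟩ := (Set.ne_univ_iff_exists_notMem A).1 hA'
  have hyB := (mem y).resolve_left hy
  rcases hA y hy with hadj | hadj
  · refine hG'.forall_of_adj (P := (· ∉ B)) hx (fun v w hvw hv hw => ?_) c hcB
    have hyv := hadj v ((mem v).resolve_right hv)
    rcases hB v hv with h | h
    · exact hvw.2 (h w hw)
    · exact h y hyB hyv.symm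
  · refine hG.forall_of_adj (P := (· ∉ B)) hx (fun v w hvw hv hw => ?_) c hcB
    have hyv := hadj v ((mem v).resolve_right hv)
    rcases hB v hv with h | h
    · exact hyv (h y hyB).symm
    · exact h w hw hvw

/-- In a finite connected and anti-connected graph, every proper homogeneous set containing `c`
lies in one that contains all the others. -/
theorem exists_greatest_isHomogeneousSet [Finite V] (hG : G.Connected) (hG' : Gᶜ.Connected)
    {c : V} {H : Set V} (hH : G.IsHomogeneousSet H) (hH' : H ≠ Set.univ) (hc : c ∈ H) :
    ∃ M, IsGreatest {K : Set V | G.IsHomogeneousSet K ∧ K ≠ Set.univ ∧ c ∈ K} M := by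
  obtain ⟨M, -, hM⟩ := (Set.toFinite
    {K : Set V | G.IsHomogeneousSet K ∧ K ≠ Set.univ ∧ c ∈ K}).exists_le_maximal ⟨hH, hH', hc⟩
  obtain ⟨h₁, h₂, h₃⟩ := hM.prop
  refine ⟨M, hM.prop, fun K ⟨k₁, k₂, k₃⟩ => ?_⟩
  exact Set.subset_union_right.trans (hM.le_of_ge
    ⟨h₁.union k₁ h₃ k₃, h₁.union_ne_univ hG hG' k₁ h₂ k₂ k₃, Or.inl h₃⟩ Set.subset_union_left)

end SimpleGraph

/-- Let `R` be a finite commutative semisimple ring (its Jacobson radical is zero) and `S`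
a subgroup of `Rˣ` with `-1 ∈ S`. If `Cay(R,S)` is connected and anti-connected, then
`Cay(R,S)` is prime. -/
theorem semisimple_cayley_is_prime {R : Type*} [CommRing R] [Fintype R]
    (hss : Ideal.jacobson (⊥ : Ideal R) = ⊥)
    (S : Set R)
    (hSunit : ∀ s ∈ S, IsUnit s)
    (hSone : (1 : R) ∈ S)
    (hSmul : ∀ a ∈ S, ∀ b ∈ S, a * b ∈ S)
    (hSinv : ∀ a ∈ S, ∀ b : R, a * b = 1 → b ∈ S)
    (hSneg : (-1 : R) ∈ S)
    (Γ : SimpleGraph R) (hΓ : ∀ x y : R, Γ.Adj x y ↔ x - y ∈ S)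
    (hconn : Γ.Connected) (hanti : Γᶜ.Connected) :
    ∀ H : Set R, Γ.IsHomogeneousSet H →
      ¬ (2 ≤ H.ncard ∧ H.ncard < Fintype.card R) := by
  rintro H hH ⟨hH₂, hHlt⟩
  obtain ⟨a, ha, b, hb, hab⟩ := (Set.one_lt_ncard (Set.toFinite H)).1 hH₂
  have hHne : H ≠ Set.univ := by
    rintro rfl
    simp [Set.ncard_univ, Nat.card_eq_fintype_card] at hHlt
  have translate (c x y : R) : Γ.Adj (x + c) (y + c) ↔ Γ.Adj x y := by
    simp [hΓ]
  have preimage_ne {K : Set R} (hK : K ≠ Set.univ) {f : R → R} (hf : f.Surjective) :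
      f ⁻¹' K ≠ Set.univ := by
    rwa [Ne, ← Set.preimage_univ (f := f), hf.preimage_injective.eq_iff]
  have hHa : (· + a) ⁻¹' H ∈ {K : Set R | Γ.IsHomogeneousSet K ∧ K ≠ Set.univ ∧ 0 ∈ K} :=
    ⟨hH.preimage (translate a), preimage_ne hHne (add_right_surjective a), by simpa using ha⟩
  obtain ⟨M, ⟨hM, hMne, hM0⟩, hMle⟩ :=
    SimpleGraph.exists_greatest_isHomogeneousSet hconn hanti hHa.1 hHa.2.1 hHa.2.2
  have hbM : b - a ∈ M := hMle hHa (by simpa using hb)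
  have sub_mem {x y : R} (hx : x ∈ M) (hy : y ∈ M) : x - y ∈ M :=
    hMle ⟨hM.preimage (translate y), preimage_ne hMne (add_right_surjective y),
      by simpa using hy⟩ (by simpa using hx)
  have exists_inv {s : R} (hs : s ∈ S) : ∃ t ∈ S, s * t = 1 := by
    obtain ⟨t, ht⟩ := (hSunit s hs).exists_right_inv
    exact ⟨t, hSinv s hs t ht, ht⟩
  have smul_mem {s x : R} (hs : s ∈ S) (hx : x ∈ M) : s * x ∈ M := by
    obtain ⟨t, ht, hst⟩ := exists_inv hs
    have cancel (z : R) : t * (s * z) = z := by linear_combination z * hst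
    refine hMle ⟨hM.preimage (f := (t * ·)) fun y z => ?_,
      preimage_ne hMne fun z => ⟨s * z, cancel z⟩, by simpa using hM0⟩ ?_
    · rw [hΓ, hΓ, ← mul_sub]
      refine ⟨fun h => ?_, hSmul t ht _⟩
      have h' := hSmul s hs _ h
      rwa [← mul_assoc, hst, one_mul] at h'
    · rw [Set.mem_preimage, cancel]
      exact hx
  have mul_mem {x : R} (hx : x ∈ M) (r : R) : r * x ∈ M := by
    refine hconn.forall_of_adj (P := fun r => r * x ∈ M) (a := 0) (by simpa using hM0)
      (fun v w hvw hv => ?_) r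
    have h := sub_mem hv (smul_mem ((hΓ v w).1 hvw) hx)
    rwa [← sub_mul, sub_sub_cancel] at h
  have one_notMem : (1 : R) ∉ M := fun h =>
    hMne (Set.eq_univ_of_forall fun r => by simpa using mul_mem h r)
  have hadj : ∀ x ∈ M, Γ.Adj 1 x :=
    (hM 1 one_notMem).resolve_right fun h => h 0 hM0 (by simpa [hΓ] using hSone)
  have hba : b - a ∈ Ideal.jacobson (⊥ : Ideal R) := by
    refine Ideal.mem_jacobson_bot.2 fun y => hSunit _ ?_
    have h := (hΓ _ _).1 (hadj _ (mul_mem hbM (-y)))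
    rwa [show 1 - -y * (b - a) = (b - a) * y + 1 by ring] at h
  rw [hss, Ideal.mem_bot, sub_eq_zero] at hba
  exact hab hba.symm
end

section
/- Let R be a finite commutative ring and ψ : R → ℂ a primitive even multiplicative function. If the generalized Paley graph P_ψ is connected and is not a complete graph, then P_ψ is prime. -/
namespace SimpleGraph.IsHomogeneousSet

variable {V : Type*} {G : SimpleGraph V} {A B : Set V}

theorem union_s17 (hA : G.IsHomogeneousSet A) (hB : G.IsHomogeneousSet B) {x : V}
    (hxA : x ∈ A) (hxB : x ∈ B) : G.IsHomogeneousSet (A ∪ B) := by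
  intro v hv
  rw [Set.mem_union, not_or] at hv
  rcases hA v hv.1 with h | h <;> rcases hB v hv.2 with h' | h'
  · exact Or.inl fun y hy => hy.elim (h y) (h' y)
  · exact absurd (h x hxA) (h' x hxB)
  · exact absurd (h' x hxB) (h x hxA)
  · exact Or.inr fun y hy => hy.elim (h y) (h' y)

theorem preimage_s17 (hA : G.IsHomogeneousSet A) (f : V → V)
    (hf : ∀ x y, G.Adj (f x) (f y) ↔ G.Adj x y) : G.IsHomogeneousSet (f ⁻¹' A) := by
  intro v hv
  rcases hA (f v) hv with h | h
  · exact Or.inl fun y hy => (hf v y).1 (h _ hy)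
  · exact Or.inr fun y hy hvy => h _ hy ((hf v y).2 hvy)

/-- If two homogeneous sets are incomparable, then the vertices of the difference are either all
adjacent or all non-adjacent to those of the second set. -/
theorem sdiff_complete_or_anticomplete (hA : G.IsHomogeneousSet A) (hB : G.IsHomogeneousSet B)
    (hBA : ¬ B ⊆ A) :
    (∀ a ∈ A \ B, ∀ b ∈ B, G.Adj a b) ∨ (∀ a ∈ A \ B, ∀ b ∈ B, ¬ G.Adj a b) := by
  obtain ⟨q, hqB, hqA⟩ := Set.not_subset.1 hBA
  rcases hA q hqA with h | h
  · refine Or.inl fun a ha => ?_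
    exact (hB a ha.2).resolve_right fun h' => h' q hqB (h a ha.1).symm
  · refine Or.inr fun a ha => ?_
    exact (hB a ha.2).resolve_left fun h' => h a ha.1 (h' q hqB).symm

end SimpleGraph.IsHomogeneousSet

theorem AddSubgroup.exists_sub_mem_of_closure_eq_top {M : Type*} [AddCommGroup M] {T : Set M}
    (hT : AddSubgroup.closure T = ⊤) {A : Set M} {a b : M} (ha : a ∈ A) (hb : b ∉ A) :
    ∃ x ∈ A, ∃ y ∉ A, y - x ∈ T ∨ x - y ∈ T := by
  by_contra! hcon
  have key : ∀ d ∈ AddSubgroup.closure T, ∀ y, y ∈ A ↔ y + d ∈ A := by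
    intro d hd
    induction hd using AddSubgroup.closure_induction with
    | mem d hd =>
      intro y
      constructor
      · intro hy
        by_contra hyd
        exact (hcon y hy _ hyd).1 (by simpa using hd)
      · intro hyd
        by_contra hy
        exact (hcon _ hyd y hy).2 (by simpa using hd)
    | zero => simp
    | add c d _ _ hc hd => intro y; rw [hc y, hd (y + c), add_assoc]
    | neg d _ hd => intro y; rw [hd (y + -d), neg_add_cancel_right]
  have := (key (b - a) (hT ▸ AddSubgroup.mem_top _) a).1 ha
  exact hb (by simpa using this)

/-- An additive subgroup stable under multiplication by a set of additive generators of the ring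
is an ideal. -/
theorem AddSubgroup.exists_ideal_of_closure_eq_top {R : Type*} [CommRing R] {T : Set R}
    (hT : AddSubgroup.closure T = ⊤) (K : AddSubgroup R) (hK : ∀ s ∈ T, ∀ k ∈ K, s * k ∈ K) :
    ∃ I : Ideal R, (I : Set R) = K := by
  have key : ∀ r ∈ AddSubgroup.closure T, ∀ k ∈ K, r * k ∈ K := by
    intro r hr
    induction hr using AddSubgroup.closure_induction with
    | mem s hs => exact hK s hs
    | zero => intro k _; simp
    | add c d _ _ hc hd => intro k hk; rw [add_mul]; exact K.add_mem (hc k hk) (hd k hk)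
    | neg d _ hd => intro k hk; rw [neg_mul]; exact K.neg_mem (hd k hk)
  exact ⟨{ K.toAddSubmonoid with
    smul_mem' := fun r k hk => key r (hT ▸ AddSubgroup.mem_top r) k hk }, rfl⟩

theorem isUnit_of_primitive {R : Type*} [CommRing R] [Finite R] {ψ : R → ℂ}
    (hmul : ∀ a b : R, ψ (a * b) = ψ a * ψ b)
    (hprim : ∀ I : Ideal R, I ≠ ⊥ → ∃ x : R, ∃ m ∈ I, ψ (x + m) ≠ ψ x)
    {u : R} (hu : ψ u ≠ 0) : IsUnit u := by
  refine IsUnit.of_mul_eq_one _ (?_ : u * (Function.surjInv (f := (u * ·)) ?_ 1) = 1)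
  · refine Finite.surjective_of_injective fun x y hxy => ?_
    by_contra hne
    obtain ⟨z, m, hm, hz⟩ := hprim (LinearMap.ker (LinearMap.mulLeft R u)) fun h => hne <| by
      have : x - y ∈ LinearMap.ker (LinearMap.mulLeft R u) := by
        simpa [mul_sub, sub_eq_zero] using hxy
      rw [h] at this
      simpa [sub_eq_zero] using this
    replace hm : u * m = 0 := by simpa using hm
    refine hz (mul_left_cancel₀ hu ?_)
    rw [← hmul, ← hmul, mul_add, hm, add_zero]
  · exact Function.surjInv_eq (f := (u * ·)) _ 1

theorem not_isHomogeneousSet_ideal {R : Type*} [CommRing R] [Finite R] {ψ : R → ℂ}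
    (hmul : ∀ a b : R, ψ (a * b) = ψ a * ψ b) (hone : ψ 1 = 1)
    (hprim : ∀ I : Ideal R, I ≠ ⊥ → ∃ x : R, ∃ m ∈ I, ψ (x + m) ≠ ψ x)
    {Γ : SimpleGraph R} (hΓ : ∀ x y : R, Γ.Adj x y ↔ x ≠ y ∧ ψ (x - y) = 1)
    {I : Ideal R} (hbot : I ≠ ⊥) (htop : I ≠ ⊤) : ¬ Γ.IsHomogeneousSet (I : Set R) := by
  intro hI
  have h1 : (1 : R) ∉ I := fun h => htop ((Ideal.eq_top_iff_one I).2 h)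
  have hone_add : ∀ m ∈ I, ψ (1 + m) = 1 := by
    intro m hm
    rcases hI 1 h1 with h | h
    · have := ((hΓ _ _).1 (h (-m) (I.neg_mem hm))).2
      rwa [sub_neg_eq_add] at this
    · exact absurd ((hΓ 1 0).2 ⟨fun h => h1 (h.symm ▸ I.zero_mem), by simpa using hone⟩)
        (h 0 I.zero_mem)
  have hne : ∀ x, ψ x ≠ 0 → ∀ m ∈ I, ψ (x + m) = ψ x := by
    intro x hx m hm
    obtain ⟨u, rfl⟩ := isUnit_of_primitive hmul hprim hx
    have : (u : R) + m = u * (1 + (↑u⁻¹ : R) * m) := by rw [mul_add]; simp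
    rw [this, hmul, hone_add _ (I.mul_mem_left _ hm), mul_one]
  obtain ⟨x, m, hm, hx⟩ := hprim I hbot
  by_cases h0 : ψ x = 0
  · by_cases h2 : ψ (x + m) = 0
    · exact hx (h2.trans h0.symm)
    · have := hne _ h2 (-m) (I.neg_mem hm)
      rw [add_neg_cancel_right] at this
      exact hx this.symm
  · exact hx (hne x h0 m hm)

/-- If `ψ : R → ℂ` is a primitive even multiplicative function on a finite commutative
ring such that the generalized Paley graph `P_ψ` is connected and not complete, then
`P_ψ` is prime: it has no non-trivial homogeneous set. -/
theorem paley_prime {R : Type*} [CommRing R] [Fintype R]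
    (ψ : R → ℂ)
    (hmul : ∀ a b : R, ψ (a * b) = ψ a * ψ b)
    (hzero : ψ 0 = 0) (hone : ψ 1 = 1) (heven : ψ (-1) = 1)
    (hprim : ∀ I : Ideal R, I ≠ ⊥ → ∃ x : R, ∃ m ∈ I, ψ (x + m) ≠ ψ x)
    (Γ : SimpleGraph R) (hΓ : ∀ x y : R, Γ.Adj x y ↔ x ≠ y ∧ ψ (x - y) = 1)
    (hconn : Γ.Connected)
    (hnotcomplete : ∃ x y : R, x ≠ y ∧ ¬ Γ.Adj x y) :
    ∀ H : Set R, Γ.IsHomogeneousSet H →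
      ¬ (2 ≤ H.ncard ∧ H.ncard < Fintype.card R) := by
  have hψneg (x : R) : ψ (-x) = ψ x := by rw [← neg_one_mul, hmul, heven, one_mul]
  have hadj (x y : R) : Γ.Adj x y ↔ ψ (x - y) = 1 := by
    rw [hΓ, and_iff_right_iff_imp]
    rintro h rfl
    rw [sub_self, hzero] at h
    exact zero_ne_one h
  have hS : AddSubgroup.closure {x : R | ψ x = 1} = ⊤ := by
    have hwalk : ∀ x y : R, Γ.Walk x y → x - y ∈ AddSubgroup.closure {x : R | ψ x = 1} := by
      intro x y w
      induction w with
      | nil => simp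
      | cons h _ ih =>
        have := add_mem (AddSubgroup.subset_closure (k := {x : R | ψ x = 1}) ((hadj _ _).1 h)) ih
        simpa using this
    refine (AddSubgroup.eq_top_iff' _).2 fun x => ?_
    obtain ⟨w⟩ := hconn.preconnected x 0
    simpa using hwalk x 0 w
  have hD : AddSubgroup.closure {x : R | ψ x ≠ 1} = ⊤ := by
    by_contra hne
    obtain ⟨I, hI⟩ := AddSubgroup.exists_ideal_of_closure_eq_top hS
      (AddSubgroup.closure {x : R | ψ x ≠ 1}) (by
        intro s hs k hk
        induction hk using AddSubgroup.closure_induction with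
        | mem k hk =>
          refine AddSubgroup.subset_closure ?_
          rw [Set.mem_ofPred_eq] at hs hk ⊢
          rwa [hmul, hs, one_mul]
        | zero => simp
        | add c d _ _ hc hd => rw [mul_add]; exact add_mem hc hd
        | neg d _ hd => rw [mul_neg]; exact neg_mem hd)
    have hsub : ∀ x, ψ x ≠ 1 → x ∈ I := fun x hx => by
      rw [← SetLike.mem_coe, hI]
      exact AddSubgroup.subset_closure hx
    refine not_isHomogeneousSet_ideal hmul hone hprim hΓ (I := I) ?_ ?_ ?_
    · rintro rfl
      obtain ⟨x, y, hxy, hn⟩ := hnotcomplete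
      rw [hadj] at hn
      exact hxy (sub_eq_zero.1 (by simpa using hsub _ hn))
    · rintro rfl
      exact hne (SetLike.coe_injective (by rw [← hI]; rfl))
    · intro v hv
      refine Or.inl fun h hh => (hadj v h).2 ?_
      by_contra hvh
      exact hv (by simpa using I.add_mem (hsub _ hvh) hh)
  rintro H₀ hH₀ ⟨hcard, hcard'⟩
  obtain ⟨a, ha, b, hb, hab⟩ := (Set.one_lt_ncard_iff_nontrivial (s := H₀)).1 hcard
  obtain ⟨c, hc⟩ : ∃ c, c ∉ H₀ := by
    by_contra! h
    rw [Set.eq_univ_of_forall h, Set.ncard_univ, Nat.card_eq_fintype_card] at hcard'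
    exact hcard'.false
  have htrans {A : Set R} (hA : Γ.IsHomogeneousSet A) (t : R) :
      Γ.IsHomogeneousSet ((· + t) ⁻¹' A) :=
    hA.preimage_s17 _ fun x y => by simp [hadj]
  obtain ⟨H, ⟨hH, h0, ⟨d, hd, hd0⟩, ⟨e, he⟩⟩, hmax⟩ := (Set.toFinite
    {A : Set R | Γ.IsHomogeneousSet A ∧ 0 ∈ A ∧ (∃ d ∈ A, d ≠ 0) ∧ ∃ e, e ∉ A}).exists_maximal
    ⟨(· + a) ⁻¹' H₀, htrans hH₀ a, by simpa using ha, ⟨b - a, by simpa using hb,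
      sub_ne_zero.2 hab.symm⟩, c - a, by simpa using hc⟩
  have hsub {B : Set R} (hB : Γ.IsHomogeneousSet B) {x e' : R} (hxH : x ∈ H) (hxB : x ∈ B)
      (he' : e' ∉ B) : B ⊆ H := by
    by_cases hcov : ∃ f, f ∉ H ∪ B
    · exact Set.subset_union_right.trans <| hmax ⟨hH.union_s17 hB hxH hxB, Or.inl h0,
        ⟨d, Or.inl hd, hd0⟩, hcov⟩ Set.subset_union_left
    · by_contra hBH
      push Not at hcov
      by_cases hHB : H ⊆ B
      · exact he' ((hcov e').elim (fun h => hHB h) id)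
      obtain ⟨p, hpH, hpB⟩ := Set.not_subset.1 hHB
      have hcompl : ∀ y, y ∉ H \ B → y ∈ B := fun y hy =>
        (hcov y).elim (fun h => by_contra fun h' => hy ⟨h, h'⟩) id
      have hx : x ∉ H \ B := fun h => h.2 hxB
      rcases hH.sdiff_complete_or_anticomplete hB hBH with h | h
      · obtain ⟨y, hy, z, hz, hyz⟩ :=
          AddSubgroup.exists_sub_mem_of_closure_eq_top hD (A := H \ B) ⟨hpH, hpB⟩ hx
        have hyz' := (hadj _ _).1 (h y hy z (hcompl z hz))
        rcases hyz with hyz | hyz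
        · exact hyz (by rw [← neg_sub, hψneg, hyz'])
        · exact hyz hyz'
      · obtain ⟨y, hy, z, hz, hyz⟩ :=
          AddSubgroup.exists_sub_mem_of_closure_eq_top hS (A := H \ B) ⟨hpH, hpB⟩ hx
        refine h y hy z (hcompl z hz) ((hadj _ _).2 ?_)
        rcases hyz with hyz | hyz
        · rw [← neg_sub, hψneg, hyz]
        · exact hyz
  let K : AddSubgroup R :=
    { carrier := H
      zero_mem' := h0
      add_mem' := fun {x y} hx hy => hsub (htrans hH (-y)) (x := y) (e' := e + y) hy
        (by simpa using h0) (by simpa using he) (by simpa using hx)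
      neg_mem' := fun {x} hx => hsub (htrans hH x) (x := 0) (e' := e - x) h0
        (by simpa using hx) (by simpa using he) (by simpa using h0) }
  obtain ⟨I, hI⟩ := AddSubgroup.exists_ideal_of_closure_eq_top hS K (by
    intro s hs k hk
    rw [Set.mem_ofPred_eq] at hs
    replace hk : k ∈ H := hk
    obtain ⟨u, rfl⟩ := isUnit_of_primitive hmul hprim (u := s) (by rw [hs]; exact one_ne_zero)
    have hu : ψ (↑u⁻¹ : R) = 1 := by
      have := hmul u (↑u⁻¹ : R)
      rwa [Units.mul_inv, hone, hs, one_mul, eq_comm] at this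
    refine hsub (hH.preimage_s17 ((↑u⁻¹ : R) * ·) fun x y => ?_) (x := 0) (e' := u * e) h0
      (by simpa using h0) (by simpa using he) (by simpa using hk)
    rw [hadj, hadj, ← mul_sub, hmul, hu, one_mul])
  have hIH : (I : Set R) = H := hI
  refine not_isHomogeneousSet_ideal hmul hone hprim hΓ (I := I) ?_ ?_ (hIH ▸ hH)
  · rintro rfl
    rw [← hIH] at hd
    exact hd0 (by simpa using hd)
  · rintro rfl
    rw [← hIH] at he
    exact he trivial
end
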